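/- arXiv:2505.18288 — 3 statements merged into one kernel-verified Lean document; each statement's English description precedes it below -/
import Mathlib

section
/- Let F : H → H be a bounded linear operator with operator norm ‖F‖ ≤ 1, let ε ≥ 0, and assume the data (w_k) satisfies ‖w_k − F e_k‖ ≤ ε for every k ∈ ℤ^d with |k|∞ ≤ K. Then for every ψ ∈ H^s, the estimator T satisfies ‖T ψ − F ψ‖ ≤ ‖ψ‖_{H^s} · (ε · γ_K + K^{−s}). -/
open scoped ComplexInnerProductSpace
open Finset

noncomputable section

/-- The cube of lattice points `k ∈ ℤ^d` with sup norm `|k|∞ ≤ K`. -/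
def cube (d K : ℕ) : Finset (Fin d → ℤ) :=
  Fintype.piFinset fun _ => Finset.Icc (-(K : ℤ)) (K : ℤ)

/-- The Sobolev weight `(1 + |k|₂²)^s`. -/
def weight (d : ℕ) (s : ℝ) (k : Fin d → ℤ) : ℝ :=
  (1 + ∑ i, ((k i : ℝ)) ^ 2) ^ s

variable {H : Type*} [NormedAddCommGroup H] [InnerProductSpace ℂ H] [CompleteSpace H]

/-- The estimator `T = ∑_{|k|∞ ≤ K} w_k ⊗ e_k`, i.e. `T u = ∑_{|k|∞ ≤ K} ⟨u, e_k⟩ w_k`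
(with the Mathlib convention that `⟪·,·⟫` is linear in the second argument, so the paper
inner product `⟨u, e_k⟩` is `⟪e k, u⟫`). -/
def estimator {d : ℕ} (e : HilbertBasis (Fin d → ℤ) ℂ H)
    (w : (Fin d → ℤ) → H) (K : ℕ) : H →L[ℂ] H :=
  ∑ k ∈ cube d K, (innerSL ℂ (e k)).smulRight (w k)

/-- The Sobolev norm `‖ψ‖_{H^s}`. -/
def sobolevNorm {d : ℕ} (s : ℝ) (e : HilbertBasis (Fin d → ℤ) ℂ H) (ψ : H) : ℝ :=
  Real.sqrt (∑' k, weight d s k * ‖⟪e k, ψ⟫‖ ^ 2)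

/-- Membership in the Sobolev space `H^s`. -/
def memSobolev {d : ℕ} (s : ℝ) (e : HilbertBasis (Fin d → ℤ) ℂ H) (ψ : H) : Prop :=
  Summable fun k => weight d s k * ‖⟪e k, ψ⟫‖ ^ 2

/-- `γ_K = (∑_{|k|∞ ≤ K} (1+|k|₂²)^{-s})^{1/2}`. -/
def gammaK (d : ℕ) (s : ℝ) (K : ℕ) : ℝ :=
  Real.sqrt (∑ k ∈ cube d K, (weight d s k)⁻¹)


theorem weight_pos {d : ℕ} (s : ℝ) (k : Fin d → ℤ) : 0 < weight d s k :=
  Real.rpow_pos_of_pos (by positivity) s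

theorem rpow_two_mul_le_weight {d K : ℕ} {s : ℝ} (hs : 0 ≤ s) {k : Fin d → ℤ}
    (hk : k ∉ cube d K) : (K : ℝ) ^ (2 * s) ≤ weight d s k := by
  obtain ⟨i, hi⟩ : ∃ i, (K : ℤ) < |k i| := by
    by_contra! h
    exact hk (Fintype.mem_piFinset.2 fun i => Finset.mem_Icc.2 (abs_le.1 (h i)))
  have hi' : (K : ℝ) ≤ |(k i : ℝ)| := by exact_mod_cast hi.le
  have h_sq : (K : ℝ) ^ 2 ≤ (k i : ℝ) ^ 2 := by
    rw [← sq_abs (k i : ℝ)]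
    gcongr
  have h_sum : (k i : ℝ) ^ 2 ≤ ∑ j, (k j : ℝ) ^ 2 :=
    Finset.single_le_sum (f := fun j => (k j : ℝ) ^ 2) (fun j _ => sq_nonneg _)
      (Finset.mem_univ i)
  rw [Real.rpow_mul (Nat.cast_nonneg K), Real.rpow_two]
  exact Real.rpow_le_rpow (by positivity) (by linarith) hs

theorem sobolevNorm_sq {d : ℕ} (s : ℝ) (e : HilbertBasis (Fin d → ℤ) ℂ H) (ψ : H) :
    sobolevNorm s e ψ ^ 2 = ∑' k, weight d s k * ‖⟪e k, ψ⟫‖ ^ 2 :=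
  Real.sq_sqrt (tsum_nonneg fun k => mul_nonneg (weight_pos s k).le (sq_nonneg _))

theorem HilbertBasis.hasSum_norm_inner_sq {ι : Type*} (e : HilbertBasis ι ℂ H) (φ : H) :
    HasSum (fun i => ‖⟪e i, φ⟫‖ ^ 2) (‖φ‖ ^ 2) := by
  have h := Complex.hasSum_re (e.hasSum_inner_mul_inner φ φ)
  have h_term : ∀ i, (⟪φ, e i⟫ * ⟪e i, φ⟫).re = ‖⟪e i, φ⟫‖ ^ 2 := fun i => by
    rw [← inner_conj_symm φ (e i), RCLike.conj_mul]
    norm_cast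
  simp only [h_term, inner_self_eq_norm_sq_to_K] at h
  exact_mod_cast h

/-- Cauchy–Schwarz for the Fourier coefficients in the cube. -/
theorem sum_norm_inner_le {d K : ℕ} {s : ℝ} (e : HilbertBasis (Fin d → ℤ) ℂ H) {ψ : H}
    (hψ : memSobolev s e ψ) :
    ∑ k ∈ cube d K, ‖⟪e k, ψ⟫‖ ≤ sobolevNorm s e ψ * gammaK d s K := by
  have h_nonneg : ∀ k, 0 ≤ weight d s k * ‖⟪e k, ψ⟫‖ ^ 2 := fun k =>
    mul_nonneg (weight_pos s k).le (sq_nonneg _)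
  have h_cs : (∑ k ∈ cube d K, ‖⟪e k, ψ⟫‖) ^ 2 ≤
      (∑ k ∈ cube d K, weight d s k * ‖⟪e k, ψ⟫‖ ^ 2) * ∑ k ∈ cube d K, (weight d s k)⁻¹ := by
    refine Finset.sum_sq_le_sum_mul_sum_of_sq_le_mul _ (fun k _ => h_nonneg k)
      (fun k _ => (inv_pos.2 (weight_pos s k)).le) fun k _ => Eq.le ?_
    have := (weight_pos s k).ne'
    field_simp
  rw [sobolevNorm, gammaK, ← Real.sqrt_mul (tsum_nonneg h_nonneg)]
  refine Real.le_sqrt_of_sq_le (h_cs.trans ?_)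
  exact mul_le_mul_of_nonneg_right (hψ.sum_le_tsum _ fun k _ => h_nonneg k)
    (Finset.sum_nonneg fun k _ => (inv_pos.2 (weight_pos s k)).le)

theorem norm_sub_sum_cube_le {d K : ℕ} (hK : 1 ≤ K) {s : ℝ} (hs : 0 ≤ s)
    (e : HilbertBasis (Fin d → ℤ) ℂ H) {ψ : H} (hψ : memSobolev s e ψ) :
    ‖ψ - ∑ k ∈ cube d K, ⟪e k, ψ⟫ • e k‖ ≤ sobolevNorm s e ψ * (K : ℝ) ^ (-s) := by
  have hK' : (0 : ℝ) < K := by exact_mod_cast hK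
  set φ := ψ - ∑ k ∈ cube d K, ⟪e k, ψ⟫ • e k with hφ
  have h_coeff : ∀ k, ⟪e k, φ⟫ = if k ∈ cube d K then 0 else ⟪e k, ψ⟫ := by
    intro k
    simp only [hφ, inner_sub_right, inner_sum, inner_smul_right,
      orthonormal_iff_ite.1 e.orthonormal]
    by_cases hk : k ∈ cube d K <;> simp [hk]
  have h_term : ∀ k, (K : ℝ) ^ (2 * s) * ‖⟪e k, φ⟫‖ ^ 2 ≤ weight d s k * ‖⟪e k, ψ⟫‖ ^ 2 := by
    intro k
    rw [h_coeff]
    split_ifs with hk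
    · simpa using mul_nonneg (weight_pos s k).le (sq_nonneg ‖⟪e k, ψ⟫‖)
    · exact mul_le_mul_of_nonneg_right (rpow_two_mul_le_weight hs hk) (sq_nonneg _)
  have h_sq : (K : ℝ) ^ (2 * s) * ‖φ‖ ^ 2 ≤ sobolevNorm s e ψ ^ 2 := by
    rw [sobolevNorm_sq]
    exact hasSum_le h_term ((e.hasSum_norm_inner_sq φ).mul_left _) hψ.hasSum
  rw [Real.rpow_neg hK'.le, ← div_eq_mul_inv, le_div_iff₀ (Real.rpow_pos_of_pos hK' s)]
  refine (abs_le_of_sq_le_sq' ?_ (Real.sqrt_nonneg _)).2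
  calc (‖φ‖ * (K : ℝ) ^ s) ^ 2 = (K : ℝ) ^ (2 * s) * ‖φ‖ ^ 2 := by
        rw [mul_comm 2 s, Real.rpow_mul hK'.le, Real.rpow_two]
        ring
    _ ≤ sobolevNorm s e ψ ^ 2 := h_sq

/-- upper bound `‖Tψ − Fψ‖ ≤ ‖ψ‖_{H^s} (ε γ_K + K^{−s})` for the estimator
built from ε-accurate data for a contraction `F`. -/
theorem estimator_error_upper_bound {d K : ℕ} (hd : 1 ≤ d) (hK : 1 ≤ K) {s : ℝ} (hs : 0 < s)
    (e : HilbertBasis (Fin d → ℤ) ℂ H) (F : H →L[ℂ] H) (hF : ‖F‖ ≤ 1)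
    (ε : ℝ) (hε : 0 ≤ ε) (w : (Fin d → ℤ) → H)
    (hw : ∀ k ∈ cube d K, ‖w k - F (e k)‖ ≤ ε)
    (ψ : H) (hψ : memSobolev s e ψ) :
    ‖estimator e w K ψ - F ψ‖
      ≤ sobolevNorm s e ψ * (ε * gammaK d s K + (K : ℝ) ^ (-s)) := by
  have h_split : estimator e w K ψ - F ψ =
      ∑ k ∈ cube d K, ⟪e k, ψ⟫ • (w k - F (e k)) -
        F (ψ - ∑ k ∈ cube d K, ⟪e k, ψ⟫ • e k) := by
    simp [estimator, smul_sub, Finset.sum_sub_distrib]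
  have h_data : ‖∑ k ∈ cube d K, ⟪e k, ψ⟫ • (w k - F (e k))‖ ≤
      sobolevNorm s e ψ * (ε * gammaK d s K) :=
    calc ‖∑ k ∈ cube d K, ⟪e k, ψ⟫ • (w k - F (e k))‖
        ≤ ∑ k ∈ cube d K, ‖⟪e k, ψ⟫‖ * ε := norm_sum_le_of_le _ fun k hk => by
          rw [norm_smul]
          exact mul_le_mul_of_nonneg_left (hw k hk) (norm_nonneg _)
      _ = (∑ k ∈ cube d K, ‖⟪e k, ψ⟫‖) * ε := (Finset.sum_mul ..).symm
      _ ≤ sobolevNorm s e ψ * gammaK d s K * ε :=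
          mul_le_mul_of_nonneg_right (sum_norm_inner_le e hψ) hε
      _ = sobolevNorm s e ψ * (ε * gammaK d s K) := by ring
  have h_tail : ‖F (ψ - ∑ k ∈ cube d K, ⟪e k, ψ⟫ • e k)‖ ≤
      sobolevNorm s e ψ * (K : ℝ) ^ (-s) :=
    (F.le_of_opNorm_le hF _).trans
      ((one_mul _).le.trans (norm_sub_sum_cube_le hK hs.le e hψ))
  rw [h_split, mul_add]
  exact (norm_sub_le _ _).trans (add_le_add h_data h_tail)
end
end

section
/- Let (η_k)_{k ∈ ℤ^d} be complex numbers with |η_k| = 1 for all k, and let F : H → H be the bounded linear operator determined by F e_k = η_k e_k for all k ∈ ℤ^d. Fix ε ≥ 0 and set w_k := η_k e_k + ε e_0 for |k|∞ ≤ K, and let T be the corresponding estimator. Then for any integer M > K and any nonnegative real coefficients (c_k)_{k ∈ ℤ^d, |k|∞ ≤ M}, the vector ψ := ∑_{|k|∞ ≤ M} c_k e_k satisfies the exact identity ‖T ψ − F ψ‖² = ε² · (∑_{k ∈ ℤ^d, |k|∞ ≤ K} c_k)² + ∑_{k ∈ ℤ^d, K < |k|∞ ≤ M} c_k². -/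
open scoped ComplexInnerProductSpace
open Finset

noncomputable section

variable {H : Type*} [NormedAddCommGroup H] [InnerProductSpace ℂ H] [CompleteSpace H]

lemma cube_mono (d : ℕ) {K M : ℕ} (h : K ≤ M) : cube d K ⊆ cube d M :=
  Fintype.piFinset_subset _ _ fun _ => Finset.Icc_subset_Icc (by omega) (by omega)

lemma zero_mem_cube (d K : ℕ) : (0 : Fin d → ℤ) ∈ cube d K := by
  simp [cube]

omit [CompleteSpace H] in
lemma estimator_apply {d : ℕ} (e : HilbertBasis (Fin d → ℤ) ℂ H)
    (w : (Fin d → ℤ) → H) (K : ℕ) (u : H) :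
    estimator e w K u = ∑ k ∈ cube d K, ⟪e k, u⟫ • w k := by
  simp [estimator]

omit [CompleteSpace H] in
/-- Parseval's identity for a finite linear combination of orthonormal vectors. -/
lemma Orthonormal.norm_sq_sum_smul {ι : Type*} {v : ι → H} (hv : Orthonormal ℂ v)
    (a : ι → ℂ) (s : Finset ι) : ‖∑ i ∈ s, a i • v i‖ ^ 2 = ∑ i ∈ s, ‖a i‖ ^ 2 := by
  have h := hv.inner_sum a a s
  simp only [inner_self_eq_norm_sq_to_K, RCLike.conj_mul] at h
  exact_mod_cast h

/-- exact error identity for the adversarially shifted solver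
`w_k = η_k e_k + ε e_0` with the diagonal evolution `F e_k = η_k e_k`. -/
theorem adversarial_solver_error_identity {d K : ℕ} (hd : 1 ≤ d) (hK : 1 ≤ K)
    (e : HilbertBasis (Fin d → ℤ) ℂ H)
    (η : (Fin d → ℤ) → ℂ) (hη : ∀ k, ‖η k‖ = 1)
    (F : H →L[ℂ] H) (hF : ∀ k, F (e k) = η k • e k)
    (ε : ℝ) (hε : 0 ≤ ε)
    (w : (Fin d → ℤ) → H) (hw : ∀ k ∈ cube d K, w k = η k • e k + (ε : ℂ) • e 0)
    (M : ℕ) (hM : K < M)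
    (c : (Fin d → ℤ) → ℝ) (hc : ∀ k ∈ cube d M, 0 ≤ c k)
    (ψ : H) (hψ : ψ = ∑ k ∈ cube d M, (c k : ℂ) • e k) :
    ‖estimator e w K ψ - F ψ‖ ^ 2
      = ε ^ 2 * (∑ k ∈ cube d K, c k) ^ 2 + ∑ k ∈ cube d M \ cube d K, c k ^ 2 := by
  have he := e.orthonormal
  have hKM := cube_mono d hM.le
  have hT : estimator e w K ψ
      = ∑ k ∈ cube d K, (c k : ℂ) • (η k • e k + (ε : ℂ) • e 0) := by
    rw [estimator_apply]
    refine sum_congr rfl fun k hk => ?_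
    rw [hψ, he.inner_right_sum (fun k => (c k : ℂ)) (hKM hk), hw k hk]
  have hFψ : F ψ = ∑ k ∈ cube d M \ cube d K, ((c k : ℂ) * η k) • e k
      + ∑ k ∈ cube d K, ((c k : ℂ) * η k) • e k := by
    rw [sum_sdiff hKM, hψ, map_sum]
    simp only [map_smul, hF, smul_smul]
  have hdiff : estimator e w K ψ - F ψ = ((ε : ℂ) * ∑ k ∈ cube d K, (c k : ℂ)) • e 0
      - ∑ k ∈ cube d M \ cube d K, ((c k : ℂ) * η k) • e k := by
    have hshift : ∑ k ∈ cube d K, (c k : ℂ) • (ε : ℂ) • e 0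
        = ((ε : ℂ) * ∑ k ∈ cube d K, (c k : ℂ)) • e 0 := by
      simp only [smul_smul, ← sum_smul, ← sum_mul, mul_comm (ε : ℂ)]
    simp only [hT, hFψ, smul_add, sum_add_distrib, hshift]
    simp only [smul_smul]
    abel
  have horth : ⟪((ε : ℂ) * ∑ k ∈ cube d K, (c k : ℂ)) • e 0,
      ∑ k ∈ cube d M \ cube d K, ((c k : ℂ) * η k) • e k⟫ = 0 := by
    rw [inner_smul_left, inner_sum]
    refine mul_eq_zero_of_right _ (sum_eq_zero fun k hk => ?_)
    have hk0 : (0 : Fin d → ℤ) ≠ k := by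
      rintro rfl
      exact (mem_sdiff.mp hk).2 (zero_mem_cube d K)
    rw [inner_smul_right, he.inner_eq_zero hk0, mul_zero]
  have hnorm : ‖(ε : ℂ) * ∑ k ∈ cube d K, (c k : ℂ)‖ ^ 2
      = ε ^ 2 * (∑ k ∈ cube d K, c k) ^ 2 := by
    rw [← Complex.ofReal_sum, ← Complex.ofReal_mul, Complex.norm_real, Real.norm_eq_abs,
      sq_abs, mul_pow]
  rw [hdiff, norm_sub_sq (𝕜 := ℂ), horth, norm_smul, he.norm_eq_one, mul_one, hnorm,
    he.norm_sq_sum_smul]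
  simp [hη]
end
end

section
/- There exists a constant c = c(s,d) > 0 with the following property. For every ε ≥ 0 and every integer cutoff K ≥ 2, there exist a unitary operator F : H → H, a family of vectors (w_k)_{|k|∞ ≤ K} with ‖w_k − F e_k‖ ≤ ε for all |k|∞ ≤ K, and a vector ψ ∈ H with ‖ψ‖ = 1 and ‖ψ‖_{H^s} ≤ 2 such that the estimator T built from (w_k) satisfies ‖T ψ − F ψ‖ ≥ c · (ε · A_K^{1/2} + K^{−s}), where A_K := ∑_{k ∈ ℤ^d, 0 < |k|∞ ≤ K} (1+|k|₂²)^{−s}. -/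
open scoped ComplexInnerProductSpace
open Finset

noncomputable section

variable {H : Type*} [NormedAddCommGroup H] [InnerProductSpace ℂ H] [CompleteSpace H]

lemma one_le_weight (d : ℕ) {s : ℝ} (hs : 0 < s) (k : Fin d → ℤ) : 1 ≤ weight d s k :=
  Real.one_le_rpow (le_add_of_nonneg_right (Finset.sum_nonneg fun _ _ => sq_nonneg _)) hs.le

lemma weight_zero (d : ℕ) (s : ℝ) : weight d s 0 = 1 := by
  simp [weight]

section FiniteCombination

variable {d : ℕ} (e : HilbertBasis (Fin d → ℤ) ℂ H) (S : Finset (Fin d → ℤ))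
  (a : (Fin d → ℤ) → ℝ)

lemma inner_sum_smul (k : Fin d → ℤ) :
    ⟪e k, ∑ j ∈ S, (a j : ℂ) • e j⟫ = if k ∈ S then (a k : ℂ) else 0 := by
  split_ifs with hk
  · exact e.orthonormal.inner_right_sum _ hk
  · rw [inner_sum]
    refine Finset.sum_eq_zero fun j hj => ?_
    rw [inner_smul_right, e.orthonormal.inner_eq_zero (by rintro rfl; exact hk hj), mul_zero]

lemma norm_sq_sum_smul : ‖∑ j ∈ S, (a j : ℂ) • e j‖ ^ 2 = ∑ j ∈ S, a j ^ 2 := by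
  have h := e.orthonormal.inner_sum (fun j => (a j : ℂ)) (fun j => (a j : ℂ)) S
  rw [inner_self_eq_norm_sq_to_K] at h
  simp only [Complex.conj_ofReal, ← sq, Complex.coe_algebraMap] at h
  refine Complex.ofReal_injective ?_
  push_cast
  exact h

lemma hasSum_weight_sum_smul (s : ℝ) :
    HasSum (fun k => weight d s k * ‖⟪e k, ∑ j ∈ S, (a j : ℂ) • e j⟫‖ ^ 2)
      (∑ k ∈ S, weight d s k * a k ^ 2) := by
  have h : ∑ k ∈ S, weight d s k * a k ^ 2 =
      ∑ k ∈ S, weight d s k * ‖⟪e k, ∑ j ∈ S, (a j : ℂ) • e j⟫‖ ^ 2 :=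
    Finset.sum_congr rfl fun k hk => by
      rw [inner_sum_smul, if_pos hk, Complex.norm_real, Real.norm_eq_abs, sq_abs]
  rw [h]
  refine hasSum_sum_of_ne_finset_zero fun k hk => ?_
  rw [inner_sum_smul, if_neg hk]
  simp

/-- Error of the estimator built from the data `e k + ε e₀` for the identity, on a combination
of the modes in the cube and one mode `m` outside it. -/
lemma estimator_sub_self {K : ℕ} (ε : ℝ) {m : Fin d → ℤ} (hm : m ∉ cube d K) :
    estimator e (fun k => e k + (ε : ℂ) • e 0) K (∑ j ∈ insert m (cube d K), (a j : ℂ) • e j)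
        - ∑ j ∈ insert m (cube d K), (a j : ℂ) • e j
      = ((ε * ∑ k ∈ cube d K, a k : ℝ) : ℂ) • e 0 - (a m : ℂ) • e m := by
  have hT : estimator e (fun k => e k + (ε : ℂ) • e 0) K
        (∑ j ∈ insert m (cube d K), (a j : ℂ) • e j)
      = ∑ k ∈ cube d K, (a k : ℂ) • (e k + (ε : ℂ) • e 0) := by
    rw [estimator, _root_.sum_apply]
    refine Finset.sum_congr rfl fun k hk => ?_
    rw [ContinuousLinearMap.smulRight_apply, innerSL_apply_apply, inner_sum_smul,
      if_pos (Finset.mem_insert_of_mem hk)]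
  rw [hT, Finset.sum_insert hm]
  simp only [smul_add, Finset.sum_add_distrib, smul_smul]
  rw [← Finset.sum_smul, ← Finset.sum_mul]
  push_cast
  rw [mul_comm (ε : ℂ)]
  abel

end FiniteCombination

/-- An orthonormal pair bounds the norm of a difference by the average of the coefficients. -/
lemma half_add_le_norm_smul_sub_smul {ι : Type*} {v : ι → H} (hv : Orthonormal ℂ v) {i j : ι}
    (hij : i ≠ j) (x y : ℝ) :
    (x + y) / 2 ≤ ‖(x : ℂ) • v i - (y : ℂ) • v j‖ := by
  have hx : x ≤ ‖(x : ℂ) • v i - (y : ℂ) • v j‖ := by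
    have h := norm_inner_le_norm (𝕜 := ℂ) (v i) ((x : ℂ) • v i - (y : ℂ) • v j)
    rw [inner_sub_right, inner_smul_right, inner_smul_right, hv.inner_eq_zero hij,
      inner_self_eq_norm_sq_to_K, hv.1 i] at h
    simp only [Complex.coe_algebraMap, Complex.ofReal_one, one_pow, mul_one, mul_zero, sub_zero,
      Complex.norm_real, one_mul] at h
    exact (le_abs_self x).trans h
  have hy : y ≤ ‖(x : ℂ) • v i - (y : ℂ) • v j‖ := by
    have h := norm_inner_le_norm (𝕜 := ℂ) (v j) ((x : ℂ) • v i - (y : ℂ) • v j)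
    rw [inner_sub_right, inner_smul_right, inner_smul_right, hv.inner_eq_zero hij.symm,
      inner_self_eq_norm_sq_to_K, hv.1 j] at h
    simp only [Complex.coe_algebraMap, Complex.ofReal_one, one_pow, mul_one, mul_zero, zero_sub,
      Complex.norm_real, one_mul, norm_neg] at h
    exact (le_abs_self y).trans h
  linarith

/-- Just outside the cube there is a mode whose weight is comparable to `K ^ (2 * s)`. -/
lemma exists_notMem_cube_le_inv_sqrt_weight {d : ℕ} (hd : 1 ≤ d) {s : ℝ} (hs : 0 < s) {K : ℕ}
    (hK : 1 ≤ K) :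
    ∃ m ∉ cube d K, (3 : ℝ) ^ (-s) * (K : ℝ) ^ (-s) ≤ (√(weight d s m))⁻¹ := by
  refine ⟨Pi.single ⟨0, hd⟩ ((K : ℤ) + 1), fun h => ?_, ?_⟩
  · have h0 := Fintype.mem_piFinset.1 h ⟨0, hd⟩
    rw [Pi.single_eq_same, Finset.mem_Icc] at h0
    omega
  · have hsum : ∑ i, ((Pi.single (⟨0, hd⟩ : Fin d) ((K : ℤ) + 1) : Fin d → ℤ) i : ℝ) ^ 2
        = ((K : ℝ) + 1) ^ 2 := by
      rw [Finset.sum_eq_single (⟨0, hd⟩ : Fin d)]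
      · simp
      · intro i _ hi
        simp [Pi.single_eq_of_ne hi]
      · simp
    have hK' : (1 : ℝ) ≤ K := by exact_mod_cast hK
    rw [← Real.mul_rpow (by norm_num) (by positivity), Real.rpow_neg (by positivity), weight, hsum]
    refine inv_anti₀ (Real.sqrt_pos.2 (by positivity)) (Real.sqrt_le_iff.2 ⟨by positivity, ?_⟩)
    rw [Real.rpow_pow_comm (by positivity)]
    exact Real.rpow_le_rpow (by positivity) (by nlinarith) hs.le

/-- A unit-norm coefficient sequence of Sobolev norm at most `2`, supported in the cube and one
further mode `m`, whose mass in the cube and at `m` is as large as possible up to constants. -/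
lemma exists_extremal_coefficients {d : ℕ} {s : ℝ} (hs : 0 < s) {K : ℕ} {m : Fin d → ℤ}
    (hm : m ∉ cube d K) :
    ∃ a : (Fin d → ℤ) → ℝ,
      ∑ k ∈ insert m (cube d K), a k ^ 2 = 1 ∧
      ∑ k ∈ insert m (cube d K), weight d s k * a k ^ 2 ≤ 4 ∧
      √(∑ k ∈ (cube d K).erase 0, (weight d s k)⁻¹) / 2 ≤ ∑ k ∈ cube d K, a k ∧
      a m = (√(weight d s m))⁻¹ / 2 := by
  set C := (cube d K).erase 0 with hC
  set A := ∑ k ∈ C, (weight d s k)⁻¹ with hA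
  have hw : ∀ k, 0 < weight d s k := fun k => zero_lt_one.trans_le (one_le_weight d hs k)
  have hA0 : 0 ≤ A := Finset.sum_nonneg fun k _ => (inv_pos.2 (hw k)).le
  have hm0 : m ≠ 0 := by rintro rfl; exact hm (zero_mem_cube d K)
  have h0C : (0 : Fin d → ℤ) ∉ C := Finset.notMem_erase _ _
  have hcube : cube d K = insert 0 C := (Finset.insert_erase (zero_mem_cube d K)).symm
  have hCm : ∀ k ∈ C, k ≠ 0 ∧ k ≠ m := fun k hk =>
    ⟨Finset.ne_of_mem_erase hk, by rintro rfl; exact hm (Finset.mem_of_mem_erase hk)⟩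
  let b : (Fin d → ℤ) → ℝ := fun k => (weight d s k)⁻¹ / √A / 2
  let β : ℝ := (√(weight d s m))⁻¹ / 2
  have hβ : weight d s m * β ^ 2 = 1 / 4 := by
    have := (hw m).ne'
    simp only [β, div_pow, inv_pow, Real.sq_sqrt (hw m).le]
    field_simp
    norm_num
  have hb : ∑ k ∈ C, weight d s k * b k ^ 2 ≤ 1 / 4 := by
    have h : ∀ k ∈ C, weight d s k * b k ^ 2 = (weight d s k)⁻¹ * (A⁻¹ / 4) := fun k _ => by
      have := (hw k).ne'
      simp only [b, div_pow, Real.sq_sqrt hA0]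
      field_simp
      norm_num
    rw [Finset.sum_congr rfl h, ← Finset.sum_mul]
    have := mul_inv_le_one (a := A)
    linarith
  have hle : ∀ k x, x ^ 2 ≤ weight d s k * x ^ 2 := fun k x =>
    le_mul_of_one_le_left (sq_nonneg x) (one_le_weight d hs k)
  have hR : β ^ 2 + ∑ k ∈ C, b k ^ 2 ≤ 1 := by
    have h1 := hle m β
    have h2 := Finset.sum_le_sum fun k (_ : k ∈ C) => hle k (b k)
    linarith
  let α : ℝ := √(1 - (β ^ 2 + ∑ k ∈ C, b k ^ 2))
  have hα : α ^ 2 = 1 - (β ^ 2 + ∑ k ∈ C, b k ^ 2) := Real.sq_sqrt (sub_nonneg.2 hR)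
  let a : (Fin d → ℤ) → ℝ := fun k => if k = 0 then α else if k = m then β else b k
  have ha0 : a 0 = α := if_pos rfl
  have ham : a m = β := by simp [a, hm0]
  have haC : ∀ k ∈ C, a k = b k := fun k hk => by simp [a, hCm k hk]
  refine ⟨a, ?_, ?_, ?_, ham⟩
  · rw [Finset.sum_insert hm, hcube, Finset.sum_insert h0C, ha0, ham, hα,
      Finset.sum_congr rfl fun k hk => congrArg (· ^ 2) (haC k hk)]
    ring
  · rw [Finset.sum_insert hm, hcube, Finset.sum_insert h0C, ha0, ham, hα, weight_zero, hβ,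
      Finset.sum_congr rfl fun k hk => congrArg (weight d s k * · ^ 2) (haC k hk)]
    have h1 : 0 ≤ ∑ k ∈ C, b k ^ 2 := Finset.sum_nonneg fun k _ => sq_nonneg _
    nlinarith [sq_nonneg β]
  · rw [hcube, Finset.sum_insert h0C, ha0, Finset.sum_congr rfl haC]
    have h : ∑ k ∈ C, b k = √A / 2 := by
      simp only [b]
      rw [← Finset.sum_div, ← Finset.sum_div, ← hA, Real.div_sqrt]
    rw [h]
    exact le_add_of_nonneg_left (Real.sqrt_nonneg _)

/-- lower bound. There is `c = c(s,d) > 0` such that for all `ε ≥ 0` and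
`K ≥ 2` there is a unitary `F`, ε-accurate data `(w_k)`, and a unit vector `ψ` with
`‖ψ‖_{H^s} ≤ 2` on which the estimator incurs error at least
`c (ε √A_K + K^{−s})`, where `A_K = ∑_{0<|k|∞≤K} (1+|k|₂²)^{−s}`. -/
theorem estimator_error_lower_bound {d : ℕ} (hd : 1 ≤ d) {s : ℝ} (hs : 0 < s)
    (e : HilbertBasis (Fin d → ℤ) ℂ H) :
    ∃ c : ℝ, 0 < c ∧ ∀ ε : ℝ, 0 ≤ ε → ∀ K : ℕ, 2 ≤ K →
      ∃ (F : H ≃ₗᵢ[ℂ] H) (w : (Fin d → ℤ) → H) (ψ : H),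
        (∀ k ∈ cube d K, ‖w k - F (e k)‖ ≤ ε) ∧
        ‖ψ‖ = 1 ∧ memSobolev s e ψ ∧ sobolevNorm s e ψ ≤ 2 ∧
        c * (ε * Real.sqrt (∑ k ∈ (cube d K).erase 0, (weight d s k)⁻¹)
              + (K : ℝ) ^ (-s))
          ≤ ‖estimator e w K ψ - F ψ‖ := by
  refine ⟨3 ^ (-s) / 4, by positivity, fun ε hε K hK => ?_⟩
  obtain ⟨m, hm, hmw⟩ := exists_notMem_cube_le_inv_sqrt_weight hd hs (one_le_two.trans hK)
  obtain ⟨a, ha1, ha4, haC, ham⟩ := exists_extremal_coefficients hs hm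
  have hm0 : (0 : Fin d → ℤ) ≠ m := by rintro rfl; exact hm (zero_mem_cube d K)
  have hsob := hasSum_weight_sum_smul e (insert m (cube d K)) a s
  refine ⟨LinearIsometryEquiv.refl ℂ H, fun k => e k + (ε : ℂ) • e 0,
    ∑ j ∈ insert m (cube d K), (a j : ℂ) • e j, fun k _ => ?_, ?_, hsob.summable, ?_, ?_⟩
  · rw [LinearIsometryEquiv.coe_refl, id_eq, add_sub_cancel_left, norm_smul, e.orthonormal.1 0,
      Complex.norm_real, Real.norm_of_nonneg hε, mul_one]
  · rw [← sq_eq_sq₀ (norm_nonneg _) zero_le_one, norm_sq_sum_smul, ha1, one_pow]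
  · rw [sobolevNorm, hsob.tsum_eq]
    exact Real.sqrt_le_iff.2 ⟨zero_le_two, by linarith⟩
  · rw [LinearIsometryEquiv.coe_refl, id_eq, estimator_sub_self e a ε hm]
    refine le_trans ?_ (half_add_le_norm_smul_sub_smul e.orthonormal hm0 _ _)
    have h3 : (3 : ℝ) ^ (-s) ≤ 1 :=
      Real.rpow_le_one_of_one_le_of_nonpos (by norm_num) (neg_nonpos.2 hs.le)
    have h4 := mul_le_mul_of_nonneg_left haC hε
    have h5 := mul_le_of_le_one_left (mul_nonneg hε
      (Real.sqrt_nonneg (∑ k ∈ (cube d K).erase 0, (weight d s k)⁻¹))) h3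
    rw [ham]
    linarith
end
end
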